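/- If μ is a smooth weight on (0,∞) satisfying μ''(u) ≤ (1/8) μ'(u)² + C₁/u² for all u in an interval I, then for any smooth f compactly supported in I, ∫_I μ'(u)² f² e^{−μ} du ≤ C₀ ( ∫_I f'² e^{−μ} du + ∫_I (f²/u²) e^{−μ} du ) with C₀ depending only on C₁. -/

import Mathlib

open MeasureTheory

lemma aux_int {f h k : ℝ → ℝ} (hf : HasCompactSupport f) (hs : tsupport f ⊆ Set.Ioi 0)
    (hk : Continuous k) (hkf : ∀ u, u ∉ tsupport f → k u = 0)
    (hh : ContinuousOn h (Set.Ioi 0)) : Integrable (fun u => k u * h u) := by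
  have hsub : tsupport (fun u => k u * h u) ⊆ tsupport f := by
    apply closure_minimal _ (isClosed_tsupport f)
    intro u hu
    by_contra hc
    exact hu (by simp [hkf u hc])
  have hc : Continuous (fun u => k u * h u) :=
    ContinuousOn.continuous_of_tsupport_subset (s := Set.Ioi 0) (hk.continuousOn.mul hh) isOpen_Ioi
      (hsub.trans hs)
  exact hc.integrable_of_hasCompactSupport (hf.of_isClosed_subset (isClosed_tsupport _) hsub)

/-- If the weight satisfies `μ'' ≤ (1/8) μ'² + C₁/u²` on an interval `I ⊆ (0, ∞)`, then
a weighted Poincaré inequality holds with constant `C₀` depending only on `C₁`. -/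
theorem stmt7 (C₁ : ℝ) (hC₁ : 0 < C₁) :
    ∃ C₀ : ℝ, 0 < C₀ ∧
      ∀ (μ f : ℝ → ℝ) (I : Set ℝ),
        I ⊆ Set.Ioi 0 → I.OrdConnected →
        ContDiffOn ℝ (⊤ : ℕ∞) μ (Set.Ioi 0) →
        ContDiff ℝ (⊤ : ℕ∞) f → HasCompactSupport f → tsupport f ⊆ I →
        (∀ u ∈ I, deriv (deriv μ) u ≤ (1 / 8) * (deriv μ u) ^ 2 + C₁ / u ^ 2) →
        ∫ u in I, (deriv μ u) ^ 2 * (f u) ^ 2 * Real.exp (-μ u)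
          ≤ C₀ * ((∫ u in I, (deriv f u) ^ 2 * Real.exp (-μ u))
              + ∫ u in I, (f u) ^ 2 / u ^ 2 * Real.exp (-μ u)) := by
  refine ⟨8 + 2 * C₁, by positivity, ?_⟩
  intro μ f I hI _ hμ hf hfc hfI hineq
  have hs : tsupport f ⊆ Set.Ioi 0 := hfI.trans hI
  have f0 : ∀ u, u ∉ tsupport f → f u = 0 := fun u hu => image_eq_zero_of_notMem_tsupport hu
  have df0 : ∀ u, u ∉ tsupport f → deriv f u = 0 := fun u hu => by
    by_contra h
    exact hu (support_deriv_subset h)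
  have hμ1 : ContDiffOn ℝ (⊤ : ℕ∞) (deriv μ) (Set.Ioi 0) :=
    hμ.deriv_of_isOpen isOpen_Ioi (by simp)
  have hμ2 : ContDiffOn ℝ (⊤ : ℕ∞) (deriv (deriv μ)) (Set.Ioi 0) :=
    hμ1.deriv_of_isOpen isOpen_Ioi (by simp)
  have c0 := hμ.continuousOn
  have c1 := hμ1.continuousOn
  have c2 := hμ2.continuousOn
  have cf := hf.continuous
  have cdf : Continuous (deriv f) := hf.continuous_deriv (by simp)
  have ce : ContinuousOn (fun u => Real.exp (-μ u)) (Set.Ioi 0) := c0.neg.rexp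
  -- integrability
  have iA : Integrable (fun u => (deriv μ u) ^ 2 * (f u) ^ 2 * Real.exp (-μ u)) := by
    have := aux_int hfc hs (k := fun u => f u ^ 2)
      (h := fun u => (deriv μ u) ^ 2 * Real.exp (-μ u)) (by fun_prop)
      (fun u hu => by simp [f0 u hu]) ((c1.pow 2).mul ce)
    refine this.congr (Filter.Eventually.of_forall fun u => ?_)
    simp only; ring
  have iB : Integrable (fun u => (deriv f u) ^ 2 * Real.exp (-μ u)) :=
    aux_int hfc hs (k := fun u => deriv f u ^ 2) (by fun_prop)
      (fun u hu => by simp [df0 u hu]) ce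
  have iD : Integrable (fun u => (f u) ^ 2 / u ^ 2 * Real.exp (-μ u)) := by
    have := aux_int hfc hs (k := fun u => f u ^ 2)
      (h := fun u => (u ^ 2)⁻¹ * Real.exp (-μ u)) (by fun_prop)
      (fun u hu => by simp [f0 u hu])
      (((continuousOn_id.pow 2).inv₀ (fun u hu => pow_ne_zero 2 (ne_of_gt hu))).mul ce)
    refine this.congr (Filter.Eventually.of_forall fun u => ?_)
    simp only; ring
  have iG : Integrable (fun u => f u ^ 2 * (deriv μ u * Real.exp (-μ u))) :=
    aux_int hfc hs (k := fun u => f u ^ 2) (by fun_prop)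
      (fun u hu => by simp [f0 u hu]) (c1.mul ce)
  have iG1 : Integrable (fun u => f u ^ 2 * ((deriv (deriv μ) u - deriv μ u ^ 2)
      * Real.exp (-μ u))) :=
    aux_int hfc hs (k := fun u => f u ^ 2) (by fun_prop)
      (fun u hu => by simp [f0 u hu]) ((c2.sub (c1.pow 2)).mul ce)
  have iG2 : Integrable (fun u => (2 * f u * deriv f u) * (deriv μ u * Real.exp (-μ u))) :=
    aux_int hfc hs (k := fun u => 2 * f u * deriv f u) (by fun_prop)
      (fun u hu => by simp [f0 u hu]) (c1.mul ce)
  have iG' := iG1.add iG2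
  have hder : ∀ u, HasDerivAt (fun u => f u ^ 2 * (deriv μ u * Real.exp (-μ u)))
      (((fun u => f u ^ 2 * ((deriv (deriv μ) u - deriv μ u ^ 2) * Real.exp (-μ u))) +
        (fun u => (2 * f u * deriv f u) * (deriv μ u * Real.exp (-μ u)))) u) u := by
    intro u
    by_cases hu : u ∈ tsupport f
    · have hu0 : Set.Ioi (0:ℝ) ∈ nhds u := isOpen_Ioi.mem_nhds (hs hu)
      have d0 : HasDerivAt μ (deriv μ u) u :=
        ((hμ.contDiffAt hu0).differentiableAt (by simp)).hasDerivAt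
      have d1 : HasDerivAt (deriv μ) (deriv (deriv μ) u) u :=
        ((hμ1.contDiffAt hu0).differentiableAt (by simp)).hasDerivAt
      have d2 : HasDerivAt f (deriv f u) u :=
        (hf.contDiffAt.differentiableAt (by simp)).hasDerivAt
      have h := (d2.fun_pow 2).fun_mul (d1.fun_mul d0.fun_neg.exp)
      refine h.congr_deriv ?_
      simp only [Pi.add_apply]
      push_cast
      ring
    · have he : f =ᶠ[nhds u] 0 := notMem_tsupport_iff_eventuallyEq.mp hu
      have : (fun u => f u ^ 2 * (deriv μ u * Real.exp (-μ u))) =ᶠ[nhds u] fun _ => (0:ℝ) := by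
        filter_upwards [he] with v hv
        simp [hv]
      have h := (hasDerivAt_const u (0:ℝ)).congr_of_eventuallyEq this
      simpa [f0 u hu] using h
  have hz := integral_eq_zero_of_hasDerivAt_of_integrable hder iG' iG
  have r : ∀ F : ℝ → ℝ, (∀ u, u ∉ tsupport f → F u = 0) → ∫ u in I, F u = ∫ u, F u :=
    fun F hF => setIntegral_eq_integral_of_forall_compl_eq_zero
      fun u hu => hF u fun h => hu (hfI h)
  rw [r _ (fun u hu => by simp [f0 u hu]), r _ (fun u hu => by simp [df0 u hu]),
    r _ (fun u hu => by simp [f0 u hu])]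
  have key := integral_mono (iA.add iG')
    (((iA.const_mul (3/8)).add (iB.const_mul 4)).add (iD.const_mul C₁)) (fun u => by
      simp only [Pi.add_apply]
      by_cases hu : u ∈ tsupport f
      · have h1 := hineq u (hfI hu)
        have h2 := mul_le_mul_of_nonneg_left h1
          (mul_nonneg (sq_nonneg (f u)) (Real.exp_pos (-μ u)).le)
        have h3 := mul_nonneg (sq_nonneg (deriv μ u * f u / 2 - 2 * deriv f u))
          (Real.exp_pos (-μ u)).le
        have h4 : f u ^ 2 / u ^ 2 * Real.exp (-μ u) * C₁
          = f u ^ 2 * Real.exp (-μ u) * (C₁ / u ^ 2) := by ring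
        linarith
      · simp [f0 u hu, df0 u hu])
  rw [integral_add' iA iG', hz, integral_add' ((iA.const_mul (3/8)).add (iB.const_mul 4))
    (iD.const_mul C₁), integral_add' (iA.const_mul (3/8)) (iB.const_mul 4),
    integral_const_mul, integral_const_mul, integral_const_mul] at key
  have nB : 0 ≤ ∫ u, (deriv f u) ^ 2 * Real.exp (-μ u) :=
    integral_nonneg fun u => by positivity
  have nD : 0 ≤ ∫ u, (f u) ^ 2 / u ^ 2 * Real.exp (-μ u) :=
    integral_nonneg fun u => by positivity
  nlinarith [mul_nonneg hC₁.le nB, mul_nonneg hC₁.le nD]
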